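/- (Theorem C, (ii)⇒(iii)) Assume R is not Gorenstein (equivalently, r ≥ 2), and let A be a non-zero minimal acyclic complex of finitely generated free R-modules in which all the free modules A_i have the same rank. If l is an integer such that H_{l−1}(A*) = 0 and H_{l+1}(A*) = 0, then H_l(A*) = 0. -/

import Mathlib

open IsLocalRing CategoryTheory

/-- The length of an `R`-module `M`: the supremum of the lengths of strictly increasing
chains of submodules of `M`.  For a module annihilated by the maximal ideal of a local
ring this coincides with the dimension over the residue field `k`. -/
noncomputable def moduleLength (R M : Type) [Ring R] [AddCommGroup M] [Module R M] : ℕ∞ :=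
  ⨆ p : LTSeries (Submodule R M), (p.length : ℕ∞)

/-- `Ext^n_R(M, N)`, as an object of `ModuleCat R`. -/
noncomputable def extModule (R : Type) [CommRing R] (M N : Type) [AddCommGroup M] [Module R M]
    [AddCommGroup N] [Module R N] (n : ℕ) : ModuleCat R :=
  ((Ext R (ModuleCat R) n).obj (Opposite.op (ModuleCat.of R M))).obj (ModuleCat.of R N)

/-- The `i`-th Betti number `β_i^R(M) = dim_k Ext^i_R(M, k)` of a module `M` over a local
ring `(R, m, k)`, computed as the length over `R` of `Ext^i_R(M, k)` (an `R`-module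
annihilated by `m`, hence a `k`-vector space). -/
noncomputable def bettiNum (R : Type) [CommRing R] [IsLocalRing R] (M : Type) [AddCommGroup M]
    [Module R M] (i : ℕ) : ℕ∞ :=
  moduleLength R (extModule R M (ResidueField R) i).carrier

/-- The `i`-th Bass number `μ^i_R = dim_k Ext^i_R(k, R)` of a local ring `(R, m, k)`. -/
noncomputable def bassNum (R : Type) [CommRing R] [IsLocalRing R] (i : ℕ) : ℕ∞ :=
  moduleLength R (extModule R (ResidueField R) R i).carrier

/-- The socle `Soc R = (0 :_R m)` of a local ring `(R, m)`. -/
noncomputable def socle (R : Type) [CommRing R] [IsLocalRing R] : Ideal R :=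
  Submodule.colon (⊥ : Ideal R) (maximalIdeal R)

/-- The socle dimension `r = dim_k (0 :_R m)` of a local ring `(R, m, k)`. -/
noncomputable def socdim (R : Type) [CommRing R] [IsLocalRing R] : ℕ∞ :=
  moduleLength R (socle R)

/-- The embedding dimension `e = dim_k (m/m²)` of a local ring `(R, m, k)`. -/
noncomputable def embdim (R : Type) [CommRing R] [IsLocalRing R] : ℕ∞ :=
  moduleLength R (CotangentSpace R)

/-- The residue field `k` is (isomorphic to) a direct summand of the `R`-module `M`,
expressed by a split injection `k → M`. -/
def kSummand (R : Type) [CommRing R] [IsLocalRing R] (M : Type) [AddCommGroup M]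
    [Module R M] : Prop :=
  ∃ (f : M →ₗ[R] ResidueField R) (g : ResidueField R →ₗ[R] M), f ∘ₗ g = LinearMap.id

/-- Vanishing of the `i`-th homology of the dual complex `A* = Hom_R(A, R)` of a chain
complex `A` with differentials `d i : A (i+1) → A i` (so that `∂_j = d (j-1)`):
every functional on `A_i` vanishing on the image of `∂_{i+1}` factors through `∂_i`.
(The index `i` is written as `i - 1 + 1` for type-checking reasons.)  Together with the
automatic inclusion `im ∂*_i ⊆ ker ∂*_{i+1}`, this says exactly `H_i(A*) = 0`. -/
def dualHomologyIsZero (R : Type) [CommRing R] (A : ℤ → Type) [∀ i, AddCommGroup (A i)]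
    [∀ i, Module R (A i)] (d : ∀ i : ℤ, A (i + 1) →ₗ[R] A i) (i : ℤ) : Prop :=
  ∀ f : A (i - 1 + 1) →ₗ[R] R, f ∘ₗ d (i - 1 + 1) = 0 →
    ∃ g : A (i - 1) →ₗ[R] R, f = g ∘ₗ d (i - 1)

theorem factor_range {R M N P : Type*} [CommRing R] [AddCommGroup M] [AddCommGroup N] [AddCommGroup P]
    [Module R M] [Module R N] [Module R P] (a : M →ₗ[R] N) (b : M →ₗ[R] P)
    (h : ∀ x, a x = 0 → b x = 0) :
    ∃ c : LinearMap.range a →ₗ[R] P, ∀ x, c ⟨a x, LinearMap.mem_range_self a x⟩ = b x := by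
  refine ⟨(Submodule.liftQ (LinearMap.ker a) b (fun x hx => h x hx)) ∘ₗ
    a.quotKerEquivRange.symm.toLinearMap, fun x => ?_⟩
  have : a.quotKerEquivRange.symm ⟨a x, LinearMap.mem_range_self a x⟩ = Submodule.Quotient.mk x := by
    rw [LinearEquiv.symm_apply_eq]; rfl
  rw [LinearMap.comp_apply, LinearEquiv.coe_coe, this]
  rfl

theorem ext_ideal {R T : Type*} [CommRing R] [IsNoetherianRing R] [IsLocalRing R]
    [AddCommGroup T] [Module R T] (h3 : maximalIdeal R ^ 3 = ⊥)
    (H : ∀ f : maximalIdeal R →ₗ[R] T, ∃ c : T, ∀ t, f t = (t : R) • c)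
    (J : Ideal R) : ∀ f : J →ₗ[R] T, ∃ c : T, ∀ t, f t = (t : R) • c := by
  induction J using WellFoundedGT.induction with
  | ind J ih =>
  intro f
  by_cases hJ : J = ⊤
  · subst hJ
    refine ⟨f ⟨1, trivial⟩, fun t => ?_⟩
    rw [← map_smul]; congr 1; ext; simp
  obtain ⟨z, hz, hmz⟩ : ∃ z, z ∉ J ∧ ∀ t ∈ maximalIdeal R, t * z ∈ J := by
    by_cases h1 : maximalIdeal R ≤ J
    · exact ⟨1, fun h => hJ ((Ideal.eq_top_iff_one _).2 h), fun t ht => by simpa using h1 ht⟩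
    by_cases h2 : maximalIdeal R ^ 2 ≤ J
    · obtain ⟨z, hz, hz'⟩ := Set.not_subset.1 h1
      refine ⟨z, hz', fun t ht => h2 ?_⟩
      rw [pow_two]; exact Ideal.mul_mem_mul ht hz
    · obtain ⟨z, hz, hz'⟩ := Set.not_subset.1 h2
      refine ⟨z, hz', fun t ht => ?_⟩
      have : t * z ∈ maximalIdeal R ^ 3 := by
        rw [pow_succ']; exact Ideal.mul_mem_mul ht hz
      rw [h3] at this
      rw [(Submodule.mem_bot R).1 this]; exact J.zero_mem
  let mz : maximalIdeal R →ₗ[R] J :=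
    LinearMap.codRestrict J ((LinearMap.toSpanSingleton R R z) ∘ₗ (maximalIdeal R).subtype)
      (fun t => by simpa using hmz t t.2)
  obtain ⟨c, hc⟩ := H (f ∘ₗ mz)
  let a : (J × R) →ₗ[R] R := LinearMap.coprod J.subtype (LinearMap.toSpanSingleton R R z)
  let b : (J × R) →ₗ[R] T := LinearMap.coprod f (LinearMap.toSpanSingleton R T c)
  have hab : ∀ x, a x = 0 → b x = 0 := by
    rintro ⟨j, r⟩ h
    have h : (j : R) + r * z = 0 := by simpa [a] using h
    have hr : r ∈ maximalIdeal R := by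
      rw [mem_maximalIdeal, mem_nonunits_iff]
      intro hu
      apply hz
      have : r * z ∈ J := by
        rw [eq_neg_of_add_eq_zero_right h]; exact J.neg_mem j.2
      exact (Ideal.unit_mul_mem_iff_mem J hu).1 this
    have e : j = - mz ⟨r, hr⟩ := by
      ext; simpa [mz] using eq_neg_of_add_eq_zero_left h
    have := hc ⟨r, hr⟩
    simp only [LinearMap.comp_apply] at this
    simp [b, e, this]
  obtain ⟨g, hg⟩ := factor_range a b hab
  have hlt : J < LinearMap.range a := by
    refine lt_of_le_of_ne (fun j hj => ⟨(⟨j, hj⟩, 0), by simp [a]⟩) ?_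
    intro h
    apply hz
    rw [h]
    exact ⟨(0, 1), by simp [a]⟩
  obtain ⟨c', hc'⟩ := ih _ hlt g
  refine ⟨c', fun t => ?_⟩
  have h1 := hg (t, 0)
  rw [hc'] at h1
  simpa [a, b] using h1.symm

theorem exists_functional {R M : Type*} [CommRing R] [IsLocalRing R] [AddCommGroup M] [Module R M]
    (x : M) (hx : x ∉ maximalIdeal R • (⊤ : Submodule R M)) :
    ∃ φ : M →ₗ[R] (R ⧸ maximalIdeal R), φ x = 1 := by
  let _ : Field (R ⧸ maximalIdeal R) := Ideal.Quotient.field _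
  let Q := M ⧸ maximalIdeal R • (⊤ : Submodule R M)
  have hx' : (Submodule.Quotient.mk x : Q) ≠ 0 := by
    rwa [Ne, Submodule.Quotient.mk_eq_zero]
  obtain ⟨f, hf⟩ : ∃ f : Module.Dual (R ⧸ maximalIdeal R) Q, f (Submodule.Quotient.mk x) ≠ 0 := by
    by_contra! h
    exact hx' ((Module.forall_dual_apply_eq_zero_iff (R ⧸ maximalIdeal R) _).1 h)
  let f' : Q →ₗ[R] (R ⧸ maximalIdeal R) :=
    { toFun := fun v => (f (Submodule.Quotient.mk x))⁻¹ * f v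
      map_add' := by intro a b; rw [map_add, mul_add]
      map_smul' := by
        intro r v
        have : r • v = (Ideal.Quotient.mk (maximalIdeal R) r) • v := by
          obtain ⟨v, rfl⟩ := Submodule.Quotient.mk_surjective _ v
          rfl
        rw [this, map_smul]
        have h2 : ∀ y : R ⧸ maximalIdeal R, r • y = (Ideal.Quotient.mk (maximalIdeal R) r) * y := by
          intro y
          obtain ⟨y, rfl⟩ := Ideal.Quotient.mk_surjective y
          rfl
        rw [RingHom.id_apply, h2, smul_eq_mul]
        ring }
  exact ⟨f' ∘ₗ Submodule.mkQ _, inv_mul_cancel₀ hf⟩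

theorem lift_of_dual {R I C P3 P2 P1 : Type*} [CommRing R] [AddCommGroup I] [Module R I] [AddCommGroup C]
    [Module R C] [AddCommGroup P3] [Module R P3] [AddCommGroup P2] [Module R P2] [AddCommGroup P1]
    [Module R P1] [Module.Projective R P2] (ι : R →ₗ[R] I) (hι : Function.Injective ι)
    (q : I →ₗ[R] C) (hq : Function.Surjective q) (hex : LinearMap.range ι = LinearMap.ker q)
    (d2 : P3 →ₗ[R] P2) (d1 : P2 →ₗ[R] P1) (hd : LinearMap.range d2 = LinearMap.ker d1)
    (H : ∀ f : P3 →ₗ[R] R, (∀ x, d2 x = 0 → f x = 0) → ∃ g : P2 →ₗ[R] R, f = g ∘ₗ d2)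
    (f : LinearMap.range d1 →ₗ[R] C) : ∃ g : LinearMap.range d1 →ₗ[R] I, ∀ x, q (g x) = f x := by
  obtain ⟨g, hg⟩ := Module.projective_lifting_property q (f ∘ₗ d1.rangeRestrict) hq
  have hg' : ∀ x, q (g x) = f (d1.rangeRestrict x) := fun x => LinearMap.congr_fun hg x
  have h1 : ∀ x, (g ∘ₗ d2) x ∈ LinearMap.range ι := by
    intro x
    rw [hex, LinearMap.mem_ker, LinearMap.comp_apply, hg']
    have : d1.rangeRestrict (d2 x) = 0 := by
      ext
      have : d2 x ∈ LinearMap.ker d1 := hd ▸ LinearMap.mem_range_self _ _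
      simpa using this
    rw [this, map_zero]
  let f3 : P3 →ₗ[R] R := (LinearEquiv.ofInjective ι hι).symm.toLinearMap ∘ₗ
    LinearMap.codRestrict (LinearMap.range ι) (g ∘ₗ d2) h1
  have hf3 : ∀ x, ι (f3 x) = g (d2 x) := by
    intro x
    have := congrArg Subtype.val ((LinearEquiv.ofInjective ι hι).apply_symm_apply (LinearMap.codRestrict (LinearMap.range ι) (g ∘ₗ d2) h1 x))
    simpa [f3] using this
  obtain ⟨g', hg''⟩ := H f3 (fun x hx => hι (by rw [hf3, hx]; simp))
  obtain ⟨c, hc⟩ := factor_range d1 (g - ι ∘ₗ g') (by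
    intro x hx
    obtain ⟨y, rfl⟩ : x ∈ LinearMap.range d2 := hd ▸ hx
    have := hf3 y
    rw [hg''] at this
    simp only [LinearMap.comp_apply] at this
    simp [this])
  refine ⟨c, ?_⟩
  rintro ⟨_, x, rfl⟩
  rw [hc]
  have : q (ι (g' x)) = 0 := by
    have : ι (g' x) ∈ LinearMap.ker q := hex ▸ LinearMap.mem_range_self _ _
    exact this
  simp only [LinearMap.sub_apply, LinearMap.comp_apply, map_sub, this, sub_zero, hg']
  rfl

theorem soclift_of_lift {R I C M : Type*} [CommRing R] [IsLocalRing R] [AddCommGroup I] [Module R I]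
    [AddCommGroup C] [Module R C] [AddCommGroup M] [Module R M] (q : I →ₗ[R] C)
    (H : ∀ f : M →ₗ[R] C, ∃ g : M →ₗ[R] I, ∀ x, q (g x) = f x)
    (x : M) (hx0 : ∀ t ∈ maximalIdeal R, t • x = 0)
    (hx : x ∉ maximalIdeal R • (⊤ : Submodule R M)) (c : C)
    (hc : ∀ t ∈ maximalIdeal R, t • c = 0) :
    ∃ u : I, (∀ t ∈ maximalIdeal R, t • u = 0) ∧ q u = c := by
  obtain ⟨φ, hφ⟩ := exists_functional x hx
  let κ : (R ⧸ maximalIdeal R) →ₗ[R] C :=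
    Submodule.liftQ (maximalIdeal R) (LinearMap.toSpanSingleton R C c)
      (fun t ht => by simpa using hc t ht)
  have hκ : κ 1 = c := by
    have : κ (Submodule.Quotient.mk 1) = (1 : R) • c := rfl
    rw [one_smul] at this
    exact this
  obtain ⟨g, hg⟩ := H (κ ∘ₗ φ)
  refine ⟨g x, fun t ht => ?_, ?_⟩
  · rw [← map_smul, hx0 t ht, map_zero]
  · rw [hg, LinearMap.comp_apply, hφ, hκ]

/-- If socle elements of `I/R` lift to socle elements of `I`, then `R` is self-injective
and so has a simple socle. -/
theorem socle_simple {R I C : Type} [CommRing R] [IsNoetherianRing R] [IsLocalRing R]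
    [AddCommGroup I] [Module R I]
    [AddCommGroup C] [Module R C] [Module.Injective R I] (h3 : maximalIdeal R ^ 3 = ⊥)
    (ι : R →ₗ[R] I) (hι : Function.Injective ι)
    (q : I →ₗ[R] C) (hex : LinearMap.range ι = LinearMap.ker q)
    (H : ∀ c : C, (∀ t ∈ maximalIdeal R, t • c = 0) →
      ∃ u : I, (∀ t ∈ maximalIdeal R, t • u = 0) ∧ q u = c)
    (x y : R) (hx : x ≠ 0)
    (hy0 : ∀ t ∈ maximalIdeal R, t * y = 0) : ∃ c, y = c * x := by
  have key : ∀ f : maximalIdeal R →ₗ[R] R, ∃ c : R, ∀ t, f t = (t : R) • c := by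
    intro f
    obtain ⟨g, hg⟩ := Module.Baer.of_injective (R := R) (Q := I) inferInstance
      (maximalIdeal R) (ι ∘ₗ f)
    have hg1 : ∀ t (ht : t ∈ maximalIdeal R), t • g 1 = ι (f ⟨t, ht⟩) := by
      intro t ht
      rw [← map_smul, smul_eq_mul, mul_one, hg t ht]; rfl
    obtain ⟨u, hu, hqu⟩ := H (q (g 1)) (by
      intro t ht
      rw [← map_smul, hg1 t ht]
      have : ι (f ⟨t, ht⟩) ∈ LinearMap.ker q := hex ▸ LinearMap.mem_range_self _ _
      exact this)
    obtain ⟨c, hc⟩ : g 1 - u ∈ LinearMap.range ι := by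
      rw [hex, LinearMap.mem_ker, map_sub, hqu, sub_self]
    refine ⟨c, fun t => hι ?_⟩
    rw [map_smul, hc, smul_sub, hu _ t.2, hg1 t t.2, sub_zero]
  obtain ⟨f, hf⟩ := factor_range (LinearMap.toSpanSingleton R R x) (LinearMap.toSpanSingleton R R y)
    (by
      intro t ht
      have ht : t * x = 0 := by simpa using ht
      have : t ∈ maximalIdeal R := by
        rw [mem_maximalIdeal, mem_nonunits_iff]
        intro hu
        exact hx ((hu.mul_right_eq_zero).1 ht)
      simpa using hy0 t this)
  obtain ⟨c, hc⟩ := ext_ideal h3 key _ f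
  refine ⟨c, ?_⟩
  have := hf 1
  rw [hc] at this
  simpa [mul_comm] using this.symm

/-- If maps `m → I/R` lift to `I`, then so do maps `m² → I/R`. -/
theorem lift_sq {R I C : Type} [CommRing R] [IsNoetherianRing R] [IsLocalRing R]
    [AddCommGroup I] [Module R I]
    [AddCommGroup C] [Module R C] [Module.Injective R I] (h3 : maximalIdeal R ^ 3 = ⊥)
    (q : I →ₗ[R] C) (hq : Function.Surjective q)
    (H : ∀ f : maximalIdeal R →ₗ[R] C, ∃ g : maximalIdeal R →ₗ[R] I, ∀ x, q (g x) = f x)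
    (J : Ideal R) (f : J →ₗ[R] C) : ∃ g : J →ₗ[R] I, ∀ x, q (g x) = f x := by
  have key : ∀ f : maximalIdeal R →ₗ[R] C, ∃ c : C, ∀ t, f t = (t : R) • c := by
    intro f
    obtain ⟨g, hg⟩ := H f
    obtain ⟨g', hg'⟩ := Module.Baer.of_injective (R := R) (Q := I) inferInstance
      (maximalIdeal R) g
    refine ⟨q (g' 1), fun t => ?_⟩
    rw [← map_smul, ← map_smul, smul_eq_mul, mul_one, hg' t t.2, hg]
  obtain ⟨c, hc⟩ := ext_ideal h3 key _ f
  obtain ⟨u, rfl⟩ := hq c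
  exact ⟨LinearMap.toSpanSingleton R I u ∘ₗ J.subtype, fun x => by simp [hc]⟩

theorem soclift_of_lift_max {R I C : Type} [CommRing R] [IsNoetherianRing R] [IsLocalRing R]
    [AddCommGroup I] [Module R I]
    [AddCommGroup C] [Module R C] [Module.Injective R I] (h3 : maximalIdeal R ^ 3 = ⊥)
    (h2 : maximalIdeal R ^ 2 ≠ ⊥)
    (q : I →ₗ[R] C) (hq : Function.Surjective q)
    (H : ∀ f : maximalIdeal R →ₗ[R] C, ∃ g : maximalIdeal R →ₗ[R] I, ∀ x, q (g x) = f x) (c : C)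
    (hc : ∀ t ∈ maximalIdeal R, t • c = 0) :
    ∃ u : I, (∀ t ∈ maximalIdeal R, t • u = 0) ∧ q u = c := by
  obtain ⟨w, hw, hw0⟩ := Submodule.exists_mem_ne_zero_of_ne_bot h2
  have kill : ∀ t ∈ maximalIdeal R, ∀ v : (maximalIdeal R ^ 2 : Ideal R), t • v = 0 := by
    intro t ht v
    ext
    have : t * v ∈ maximalIdeal R ^ 3 := by
      rw [pow_succ']; exact Ideal.mul_mem_mul ht v.2
    rw [h3] at this
    simpa using this
  refine soclift_of_lift q (lift_sq h3 q hq H (maximalIdeal R ^ 2)) ⟨w, hw⟩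
    (fun t ht => kill t ht _) ?_ c hc
  intro h
  have : maximalIdeal R • (⊤ : Submodule R (maximalIdeal R ^ 2 : Ideal R)) ≤ ⊥ :=
    Submodule.smul_le.2 (fun t ht v _ => by simp [kill t ht v])
  exact hw0 (congrArg Subtype.val ((Submodule.mem_bot R).1 (this h)))

/-- A socle summand of the image of `d0` makes `m` a retract of its kernel. -/
theorem lift_max_of_summand {R I C P1 P0 : Type*} [CommRing R] [IsLocalRing R] [AddCommGroup I]
    [Module R I] [AddCommGroup C] [Module R C] [AddCommGroup P1] [Module R P1]
    [AddCommGroup P0] [Module R P0] [Module.Projective R P1]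
    (q : I →ₗ[R] C) (d0 : P1 →ₗ[R] P0) (N : Submodule R P1) (hN : N = LinearMap.ker d0)
    (H : ∀ f : N →ₗ[R] C, ∃ g : N →ₗ[R] I, ∀ x, q (g x) = f x)
    (x : LinearMap.range d0) (hx0 : ∀ t ∈ maximalIdeal R, t • x = 0)
    (hx : x ∉ maximalIdeal R • (⊤ : Submodule R (LinearMap.range d0)))
    (f : maximalIdeal R →ₗ[R] C) : ∃ g : maximalIdeal R →ₗ[R] I, ∀ x, q (g x) = f x := by
  obtain ⟨φ, hφ⟩ := exists_functional x hx
  obtain ⟨ψ, hψ⟩ := Module.projective_lifting_property (Submodule.mkQ (maximalIdeal R))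
    (φ ∘ₗ d0.rangeRestrict) (Submodule.mkQ_surjective _)
  have hψ' : ∀ z, (Ideal.Quotient.mk (maximalIdeal R)) (ψ z) = φ (d0.rangeRestrict z) :=
    fun z => LinearMap.congr_fun hψ z
  obtain ⟨y, hy⟩ := d0.surjective_rangeRestrict x
  have hu : IsUnit (ψ y) := by
    by_contra hu
    have h := hψ' y
    rw [hy, hφ, Ideal.Quotient.eq_zero_iff_mem.2 ((mem_maximalIdeal _).2 hu)] at h
    exact zero_ne_one h
  obtain ⟨v, hv⟩ := hu.exists_left_inv
  have hψN : ∀ z ∈ N, ψ z ∈ maximalIdeal R := by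
    intro z hz
    rw [← Ideal.Quotient.eq_zero_iff_mem, hψ']
    have : d0.rangeRestrict z = 0 := by
      ext; rw [hN] at hz; exact hz
    rw [this, map_zero]
  have hyN : ∀ t ∈ maximalIdeal R, t • (v • y) ∈ N := by
    intro t ht
    rw [hN, LinearMap.mem_ker, smul_comm, map_smul]
    have := congrArg Subtype.val (hx0 t ht)
    rw [← hy] at this
    have h2 : d0 (t • y) = 0 := by simpa using this
    rw [h2, smul_zero]
  let p : N →ₗ[R] maximalIdeal R := LinearMap.codRestrict _ (ψ ∘ₗ N.subtype) (fun z => hψN z z.2)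
  let s : maximalIdeal R →ₗ[R] N := LinearMap.codRestrict N
    (LinearMap.toSpanSingleton R P1 (v • y) ∘ₗ (maximalIdeal R).subtype) (fun t => hyN t t.2)
  have hps : ∀ t, p (s t) = t := by
    intro t
    apply Subtype.ext
    change ψ ((t : R) • (v • y)) = t
    simp [hv]
  obtain ⟨g, hg⟩ := H (f ∘ₗ p)
  exact ⟨g ∘ₗ s, fun t => by simp [hg, hps]⟩

theorem mem_smul_top_of_mem {R M : Type*} [CommRing R] [AddCommGroup M] [Module R M]
    (J : Ideal R) (N : Submodule R M) (x : N) (h : x ∈ J • (⊤ : Submodule R N)) :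
    (x : M) ∈ J • N := by
  have := Submodule.mem_map_of_mem (f := N.subtype) h
  rwa [Submodule.map_smul'', Submodule.map_top, Submodule.range_subtype] at this

/-- Vanishing of the dual homology forces the two next syzygies to have no socle summand. -/
theorem sq_le_of_dual {R P3 P2 P1 P0 : Type} [CommRing R] [IsNoetherianRing R] [IsLocalRing R]
    [AddCommGroup P3] [Module R P3] [AddCommGroup P2] [Module R P2] [AddCommGroup P1]
    [Module R P1] [AddCommGroup P0] [Module R P0] [Module.Projective R P2] [Module.Projective R P1]
    (h3 : maximalIdeal R ^ 3 = ⊥) (h2 : maximalIdeal R ^ 2 ≠ ⊥)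
    (x y : R) (hx : x ≠ 0)
    (hy0 : ∀ t ∈ maximalIdeal R, t * y = 0) (hxy : ∀ c, y ≠ c * x)
    (d2 : P3 →ₗ[R] P2) (d1 : P2 →ₗ[R] P1) (d0 : P1 →ₗ[R] P0)
    (e1 : LinearMap.range d2 = LinearMap.ker d1) (e0 : LinearMap.range d1 = LinearMap.ker d0)
    (s1 : maximalIdeal R ^ 2 • (⊤ : Submodule R P1) ≤ LinearMap.range d1)
    (s0 : maximalIdeal R ^ 2 • (⊤ : Submodule R P0) ≤ LinearMap.range d0)
    (H : ∀ f : P3 →ₗ[R] R, (∀ x, d2 x = 0 → f x = 0) → ∃ g : P2 →ₗ[R] R, f = g ∘ₗ d2) :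
    maximalIdeal R ^ 2 • (⊤ : Submodule R P1) ≤ maximalIdeal R • LinearMap.range d1 ∧
    maximalIdeal R ^ 2 • (⊤ : Submodule R P0) ≤ maximalIdeal R • LinearMap.range d0 := by
  obtain ⟨I, _, _, hI, ι, hι⟩ : ∃ (I : Type) (_ : AddCommGroup I) (_ : Module R I),
      Module.Injective R I ∧ ∃ ι : R →ₗ[R] I, Function.Injective ι := by
    let X := CategoryTheory.Injective.under (ModuleCat.of R R)
    refine ⟨X, inferInstance, inferInstance, ?_,
      (CategoryTheory.Injective.ι (ModuleCat.of R R)).hom, ?_⟩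
    · have hX : CategoryTheory.Injective X :=
        CategoryTheory.Injective.injective_under (ModuleCat.of R R)
      exact Module.injective_module_of_injective_object R X (inj := hX)
    · exact (ModuleCat.mono_iff_injective _).1 inferInstance
  let q := Submodule.mkQ (LinearMap.range ι)
  have hq : Function.Surjective q := Submodule.mkQ_surjective _
  have hex : LinearMap.range ι = LinearMap.ker q := (Submodule.ker_mkQ _).symm
  have kill : ∀ (P : Type) [AddCommGroup P] [Module R P],
      ∀ z ∈ maximalIdeal R ^ 2 • (⊤ : Submodule R P), ∀ t ∈ maximalIdeal R, t • z = 0 := by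
    intro P _ _ z hz t ht
    have : t • z ∈ maximalIdeal R • maximalIdeal R ^ 2 • (⊤ : Submodule R P) :=
      Submodule.smul_mem_smul ht hz
    rw [← mul_smul, ← pow_succ', h3] at this
    simpa using this
  have L := lift_of_dual ι hι q hq hex d2 d1 e1 H
  constructor
  · intro z hz
    by_contra hn
    obtain ⟨c, hc⟩ := socle_simple h3 ι hι q hex
      (soclift_of_lift q L ⟨z, s1 hz⟩ (fun t ht => Subtype.ext (kill _ z hz t ht))
        (fun h => hn (mem_smul_top_of_mem _ _ _ h))) x y hx hy0
    exact hxy c hc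
  · intro z hz
    by_contra hn
    obtain ⟨c, hc⟩ := socle_simple h3 ι hι q hex
      (soclift_of_lift_max h3 h2 q hq
        (lift_max_of_summand q d0 _ e0 L ⟨z, s0 hz⟩
          (fun t ht => Subtype.ext (kill _ z hz t ht))
          (fun h => hn (mem_smul_top_of_mem _ _ _ h)))) x y hx hy0
    exact hxy c hc

theorem len_sub_quot {R M : Type*} [CommRing R] [AddCommGroup M] [Module R M] (K : Submodule R M) :
    Module.length R M = Module.length R K + Module.length R (M ⧸ K) :=
  Module.length_eq_add_of_exact K.subtype K.mkQ K.injective_subtype K.mkQ_surjective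
    (LinearMap.exact_subtype_mkQ K)

theorem len_ker_range {R M N : Type*} [CommRing R] [AddCommGroup M] [Module R M] [AddCommGroup N]
    [Module R N] (f : M →ₗ[R] N) :
    Module.length R M = Module.length R (LinearMap.ker f) + Module.length R (LinearMap.range f) := by
  rw [len_sub_quot (LinearMap.ker f), f.quotKerEquivRange.length_eq]

theorem len_range_le {R P Q : Type*} [CommRing R] [IsLocalRing R] [AddCommGroup P] [Module R P]
    [AddCommGroup Q] [Module R Q] (φ : P →ₗ[R] Q)
    (h : LinearMap.range φ ≤ maximalIdeal R • (⊤ : Submodule R Q)) :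
    Module.length R (LinearMap.range φ) ≤
      Module.length R (P ⧸ maximalIdeal R • (⊤ : Submodule R P)) +
      Module.length R (maximalIdeal R ^ 2 • (⊤ : Submodule R Q) : Submodule R Q) := by
  let N := LinearMap.range φ
  let S := maximalIdeal R ^ 2 • (⊤ : Submodule R Q)
  let K : Submodule R N := S.comap N.subtype
  rw [len_sub_quot K, add_comm]
  apply add_le_add
  · have hle : maximalIdeal R • (⊤ : Submodule R P) ≤ K.comap φ.rangeRestrict := by
      rw [Submodule.smul_le]
      intro t ht p _
      change φ (t • p) ∈ S
      rw [map_smul]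
      have : S = maximalIdeal R • maximalIdeal R • (⊤ : Submodule R Q) := by
        rw [← mul_smul, ← pow_two]
      rw [this]
      exact Submodule.smul_mem_smul ht (h (LinearMap.mem_range_self φ p))
    apply Module.length_le_of_surjective (Submodule.mapQ _ K φ.rangeRestrict hle)
    intro z
    obtain ⟨z, rfl⟩ := Submodule.Quotient.mk_surjective _ z
    obtain ⟨p, rfl⟩ := φ.surjective_rangeRestrict z
    exact ⟨Submodule.Quotient.mk p, rfl⟩
  · apply Module.length_le_of_injective
      (LinearMap.codRestrict S (N.subtype ∘ₗ K.subtype) (fun z => z.2))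
    intro a b hab
    exact Subtype.ext (Subtype.ext (congrArg (fun z : S => (z : Q)) hab))

theorem len_range_ge {R P Q : Type*} [CommRing R] [IsLocalRing R] [AddCommGroup P] [Module R P]
    [AddCommGroup Q] [Module R Q] (φ : P →ₗ[R] Q)
    (hk : LinearMap.ker φ ≤ maximalIdeal R • (⊤ : Submodule R P))
    (h : maximalIdeal R ^ 2 • (⊤ : Submodule R Q) ≤ maximalIdeal R • LinearMap.range φ) :
      Module.length R (P ⧸ maximalIdeal R • (⊤ : Submodule R P)) +
      Module.length R (maximalIdeal R ^ 2 • (⊤ : Submodule R Q) : Submodule R Q) ≤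
    Module.length R (LinearMap.range φ) := by
  let N := LinearMap.range φ
  let S := maximalIdeal R • N
  let K : Submodule R N := S.comap N.subtype
  have hSN : S ≤ N := Submodule.smul_le_right
  rw [len_sub_quot K, add_comm]
  have hS : S = (maximalIdeal R • (⊤ : Submodule R P)).map φ := by
    rw [Submodule.map_smul'', Submodule.map_top]
  apply add_le_add
  · apply Module.length_le_of_injective
      (LinearMap.codRestrict K (LinearMap.codRestrict N (Submodule.subtype _)
        (fun z => hSN (h z.2))) (fun z => h z.2))
    intro a b hab
    exact Subtype.ext (congrArg (fun z : K => ((z : N) : Q)) hab)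
  · have hle : maximalIdeal R • (⊤ : Submodule R P) ≤ K.comap φ.rangeRestrict := by
      intro p hp
      change φ p ∈ S
      rw [hS]
      exact Submodule.mem_map_of_mem hp
    apply Module.length_le_of_injective (Submodule.mapQ _ K φ.rangeRestrict hle)
    rw [injective_iff_map_eq_zero]
    intro z
    obtain ⟨p, rfl⟩ := Submodule.Quotient.mk_surjective _ z
    intro hz
    have hz : φ p ∈ S := (Submodule.Quotient.mk_eq_zero K).1 hz
    rw [hS] at hz
    obtain ⟨p', hp', e⟩ := hz
    rw [Submodule.Quotient.mk_eq_zero]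
    have : p - p' ∈ LinearMap.ker φ := by rw [LinearMap.mem_ker, map_sub, e, sub_self]
    have := Submodule.add_mem _ (hk this) hp'
    simpa using this

theorem len_smul_congr {R P Q : Type*} [CommRing R] [AddCommGroup P] [Module R P]
    [AddCommGroup Q] [Module R Q] (e : P ≃ₗ[R] Q) (J : Ideal R) :
    Module.length R (J • (⊤ : Submodule R P) : Submodule R P) =
      Module.length R (J • (⊤ : Submodule R Q) : Submodule R Q) ∧
    Module.length R (P ⧸ J • (⊤ : Submodule R P)) =
      Module.length R (Q ⧸ J • (⊤ : Submodule R Q)) := by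
  have h : (J • (⊤ : Submodule R P)).map e.toLinearMap = J • (⊤ : Submodule R Q) := by
    rw [Submodule.map_smul'', Submodule.map_top, LinearEquiv.range]
  constructor
  · rw [(e.submoduleMap (J • (⊤ : Submodule R P))).length_eq, ← h]
  · exact (Submodule.Quotient.equiv _ _ e h).length_eq

theorem dualMap_minimal {R P Q : Type*} [CommRing R] [IsLocalRing R] [AddCommGroup P] [Module R P]
    [AddCommGroup Q] [Module R Q] [Module.Free R P] [Module.Finite R P] (φ : P →ₗ[R] Q)
    (h : LinearMap.range φ ≤ maximalIdeal R • (⊤ : Submodule R Q)) :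
    LinearMap.range φ.dualMap ≤ maximalIdeal R • (⊤ : Submodule R (Module.Dual R P)) := by
  rintro _ ⟨f, rfl⟩
  let b := Module.Free.chooseBasis R P
  rw [← b.sum_dual_apply_smul_coord (φ.dualMap f)]
  refine Submodule.sum_mem _ (fun i _ => Submodule.smul_mem_smul ?_ trivial)
  have := Submodule.mem_map_of_mem (f := f) (h (LinearMap.mem_range_self φ (b i)))
  rw [Submodule.map_smul''] at this
  exact Ideal.mul_le_left (J := LinearMap.range f) (I := maximalIdeal R) (by simpa using this)

theorem exists_socle {R : Type} [CommRing R] [IsLocalRing R] (h : 2 ≤ socdim R) :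
    ∃ x y : R, x ≠ 0 ∧ (∀ t ∈ maximalIdeal R, t * y = 0) ∧ ∀ c, y ≠ c * x := by
  have h1 : (1 : ℕ∞) < socdim R := lt_of_lt_of_le (by norm_num) h
  obtain ⟨p, hp⟩ := lt_iSup_iff.1 h1
  have hp : 1 < p.length := by exact_mod_cast hp
  have l1 : p ⟨0, by omega⟩ < p ⟨1, by omega⟩ := p.strictMono (Fin.mk_lt_mk.2 (by norm_num))
  have l2 : p ⟨1, by omega⟩ < p ⟨2, by omega⟩ := p.strictMono (Fin.mk_lt_mk.2 (by norm_num))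
  obtain ⟨x, hx, hx'⟩ := SetLike.exists_of_lt l1
  obtain ⟨y, hy, hy'⟩ := SetLike.exists_of_lt l2
  refine ⟨x, y, ?_, ?_, ?_⟩
  · intro h
    apply hx'
    have : x = 0 := Subtype.ext h
    rw [this]; exact Submodule.zero_mem _
  · intro t ht
    have := Submodule.mem_colon.1 y.2 t ht
    simpa [mul_comm] using this
  · intro c hc
    apply hy'
    have : y = c • x := Subtype.ext hc
    rw [this]
    exact Submodule.smul_mem _ _ hx

/-- Theorem C, (ii) ⇒ (iii): let `(R, m, k)` be a local ring with `m³ = 0 ≠ m²` which is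
not Gorenstein (equivalently, `r ≥ 2`), and let `A` be a non-zero minimal acyclic
complex of finitely generated free `R`-modules in which all modules have the same rank.
If `H_{l−1}(A*) = 0` and `H_{l+1}(A*) = 0`, then `H_l(A*) = 0`. -/
theorem theorem_C_ii_iii (R : Type) [CommRing R] [IsNoetherianRing R] [IsLocalRing R]
    (h3 : maximalIdeal R ^ 3 = ⊥) (h2 : maximalIdeal R ^ 2 ≠ ⊥)
    (hnotGor : 2 ≤ socdim R)
    (A : ℤ → Type) [∀ i, AddCommGroup (A i)] [∀ i, Module R (A i)]
    (hfree : ∀ i, Module.Free R (A i)) (hfin : ∀ i, Module.Finite R (A i))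
    (d : ∀ i : ℤ, A (i + 1) →ₗ[R] A i)
    (hcx : ∀ i, d i ∘ₗ d (i + 1) = 0)
    (hacyclic : ∀ i, LinearMap.range (d (i + 1)) = LinearMap.ker (d i))
    (hmin : ∀ i, LinearMap.range (d i) ≤ maximalIdeal R • (⊤ : Submodule R (A i)))
    (hnz : ∃ i, Nontrivial (A i))
    (hrank : ∀ i j : ℤ, Module.finrank R (A i) = Module.finrank R (A j))
    (l : ℤ) (hl1 : dualHomologyIsZero R A d (l - 1)) (hl2 : dualHomologyIsZero R A d (l + 1)) :
    dualHomologyIsZero R A d l := by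
  obtain ⟨x, y, hx, hy0, hxy⟩ := exists_socle hnotGor
  let P : ℤ → Prop := fun i => ∀ f : A (i + 1) →ₗ[R] R, f ∘ₗ d (i + 1) = 0 →
    ∃ g : A i →ₗ[R] R, f = g ∘ₗ d i
  obtain ⟨j, rfl⟩ : ∃ j, l = j + 1 + 1 := ⟨l - 2, by ring⟩
  have p0 : P j := by
    have h : P (j + 1 + 1 - 1 - 1) := hl1
    rwa [show j + 1 + 1 - 1 - 1 = j by ring] at h
  have p2 : P (j + 1 + 1) := by
    have h : P (j + 1 + 1 + 1 - 1) := hl2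
    rwa [show j + 1 + 1 + 1 - 1 = j + 1 + 1 by ring] at h
  suffices p1 : P (j + 1) by
    change P (j + 1 + 1 - 1)
    rwa [show j + 1 + 1 - 1 = j + 1 by ring]
  clear hl1 hl2
  have : IsArtinianRing R := (isArtinianRing_iff_isNilpotent_maximalIdeal R).2 ⟨3, h3⟩
  -- the range of each differential contains `m² A`
  have sq : ∀ i, maximalIdeal R ^ 2 • (⊤ : Submodule R (A i)) ≤ LinearMap.range (d i) := by
    have : ∀ i, maximalIdeal R ^ 2 • (⊤ : Submodule R (A (i + 1))) ≤
        LinearMap.range (d (i + 1)) := by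
      intro i
      rw [hacyclic, Submodule.smul_le]
      intro t ht z _
      rw [LinearMap.mem_ker, map_smul]
      have : t • d i z ∈ maximalIdeal R ^ 2 • maximalIdeal R • (⊤ : Submodule R (A i)) :=
        Submodule.smul_mem_smul ht (hmin i (LinearMap.mem_range_self _ z))
      rw [← mul_smul, ← pow_succ, h3] at this
      simpa using this
    intro i
    have h := this (i - 1)
    rwa [show i - 1 + 1 = i by ring] at h
  obtain ⟨q1, q0⟩ := sq_le_of_dual h3 h2 x y hx hy0 hxy (d (j + 1 + 1)) (d (j + 1)) (d j)
    (hacyclic _) (hacyclic _) (sq _) (sq _) (by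
      intro f hf
      apply p2 f
      ext z
      apply hf
      have := LinearMap.congr_fun (hcx (j + 1 + 1)) z
      exact this)
  have eqv : ∀ i, Nonempty (A i ≃ₗ[R] A j) := fun i =>
    ⟨LinearEquiv.ofFinrankEq _ _ (hrank i j)⟩
  have eqvd : ∀ i, Nonempty (Module.Dual R (A i) ≃ₗ[R] A j) := fun i =>
    ⟨((Module.Free.chooseBasis R (A i)).toDualEquiv).symm.trans (eqv i).some⟩
  set κ := Module.length R (A j ⧸ maximalIdeal R • (⊤ : Submodule R (A j))) with hκ
  set σ := Module.length R (maximalIdeal R ^ 2 • (⊤ : Submodule R (A j)) : Submodule R (A j)) with hσ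
  set lam := Module.length R (A j) with hlam
  have lamfin : lam ≠ ⊤ := Module.length_ne_top
  have g1 := len_range_ge (d (j + 1)) (hacyclic (j + 1) ▸ hmin _) q1
  have g0 := len_range_ge (d j) (hacyclic j ▸ hmin _) q0
  rw [(len_smul_congr (eqv _).some _).2, (len_smul_congr (eqv _).some _).1] at g1
  rw [(len_smul_congr (eqv _).some _).2] at g0
  have g2 := len_ker_range (d j)
  rw [← hacyclic, (eqv _).some.length_eq] at g2
  rw [← hκ, ← hσ] at g1 g0
  rw [← hlam] at g2
  let B : ∀ i, Submodule R (Module.Dual R (A (i + 1))) := fun i => LinearMap.range (d i).dualMap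
  let Z : ∀ i, Submodule R (Module.Dual R (A (i + 1))) := fun i => LinearMap.ker (d (i + 1)).dualMap
  have hB : ∀ i, Module.length R (B i) ≤ κ + σ := by
    intro i
    have := len_range_le (d i).dualMap (dualMap_minimal _ (hmin i))
    rwa [(len_smul_congr (eqvd _).some _).2, (len_smul_congr (eqvd _).some _).1] at this
  have hZB : ∀ i, lam = Module.length R (Z i) + Module.length R (B (i + 1)) := by
    intro i
    have := len_ker_range (d (i + 1)).dualMap
    rwa [(eqvd _).some.length_eq] at this
  have hBZ : ∀ i, B i ≤ Z i := by
    rintro i _ ⟨g, rfl⟩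
    rw [LinearMap.mem_ker]
    ext z
    have := LinearMap.congr_fun (hcx i) z
    simp only [LinearMap.comp_apply, LinearMap.zero_apply] at this
    simp [this]
  have hPZ : ∀ i, P i → B i = Z i := by
    intro i hp
    apply le_antisymm (hBZ i)
    intro f hf
    obtain ⟨g, hg⟩ := hp f hf
    exact ⟨g, hg.symm⟩
  have z0 := hZB j
  have z1 := hZB (j + 1)
  have z2 := hZB (j + 1 + 1)
  have b0 := hB j
  have b1 := hB (j + 1)
  have b2 := hB (j + 1 + 1)
  have b3 := hB (j + 1 + 1 + 1)
  rw [← hPZ _ p0] at z0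
  rw [← hPZ _ p2] at z2
  have fin : ∀ i, Module.length R (B i) ≠ ⊤ := fun i => Module.length_ne_top
  have finZ : ∀ i, Module.length R (Z i) ≠ ⊤ := fun i => Module.length_ne_top
  have key : Module.length R (Z (j + 1)) ≤ Module.length R (B (j + 1)) := by
    have f1 : Module.length R (LinearMap.range (d (j + 1))) ≠ ⊤ := Module.length_ne_top
    have f2 : Module.length R (LinearMap.range (d j)) ≠ ⊤ := Module.length_ne_top
    have f3 : κ ≠ ⊤ := Module.length_ne_top
    have f4 : σ ≠ ⊤ := Module.length_ne_top
    have F0 := fin j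
    have F1 := fin (j + 1)
    have F2 := fin (j + 1 + 1)
    have F3 := fin (j + 1 + 1 + 1)
    have F4 := finZ (j + 1)
    clear_value lam κ σ
    generalize Module.length R (LinearMap.range (d (j + 1))) = v1 at *
    generalize Module.length R (LinearMap.range (d j)) = v2 at *
    generalize Module.length R (B j) = w0 at *
    generalize Module.length R (B (j + 1)) = w1 at *
    generalize Module.length R (B (j + 1 + 1)) = w2 at *
    generalize Module.length R (B (j + 1 + 1 + 1)) = w3 at *
    generalize Module.length R (Z (j + 1)) = w4 at *
    lift v1 to ℕ using f1
    lift v2 to ℕ using f2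
    lift κ to ℕ using f3
    lift σ to ℕ using f4
    lift lam to ℕ using lamfin
    lift w0 to ℕ using F0
    lift w1 to ℕ using F1
    lift w2 to ℕ using F2
    lift w3 to ℕ using F3
    lift w4 to ℕ using F4
    norm_cast at g0 g1 g2 z0 z1 z2 b0 b1 b2 b3 ⊢
    omega
  have hEq : B (j + 1) = Z (j + 1) := by
    by_contra hne
    have hlt := lt_of_le_of_ne (hBZ (j + 1)) hne
    have := Submodule.height_strictMono hlt
    rw [← Module.length_submodule, ← Module.length_submodule] at this
    exact absurd key (not_le.2 this)
  intro f hf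
  have : f ∈ B (j + 1) := by
    rw [hEq]
    exact hf
  obtain ⟨g, hg⟩ := this
  exact ⟨g, hg.symm⟩
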